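/- For any four 2×2 complex matrices A₁, A₂, A₃, A₄ with A(z) = z₁A₁+z₂A₂+z₃A₃+z₄A₄ invertible, writing B(z) for the adjugate of A(z), the quantity tr(B A₁ B A₂ B A₃ - B A₁ B A₃ B A₂)/det(A(z)) · (1/(-z₄)) is the constant C = -det M, where M is the 4×4 matrix whose j-th column consists of the four entries (a₁^j, a₂^j, a₃^j, a₄^j) of A_j. Equivalently: for 2×2 matrices, det²(A(z)) · tr((A(z)⁻¹A₁)(A(z)⁻¹A₂)(A(z)⁻¹A₃) - (A(z)⁻¹A₁)(A(z)⁻¹A₃)(A(z)⁻¹A₂)) = -C·z₄·? — state as: the function z ↦ tr(BA₁BA₂BA₃ - BA₁BA₃BA₂)/(z₄ det A(z)) is a constant independent of z on {z : z₄ ≠ 0, det A(z) ≠ 0}, equal to det of the 4×4 matrix of entries of A₁,…,A₄ up to sign. -/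

import Mathlib

/-- The determinant of the matrix of entries, as an explicit polynomial in the entries. -/
def entryDet (X Y Z P : Matrix (Fin 2) (Fin 2) ℂ) : ℂ :=
  (Matrix.of ![![X 0 0, Y 0 0, Z 0 0, P 0 0], ![X 0 1, Y 0 1, Z 0 1, P 0 1],
    ![X 1 0, Y 1 0, Z 1 0, P 1 0], ![X 1 1, Y 1 1, Z 1 1, P 1 1]]).det

theorem trace_eq_det_mul_entryDet (X Y Z P : Matrix (Fin 2) (Fin 2) ℂ) :
    (P.adjugate * X * P.adjugate * Y * P.adjugate * Z
      - P.adjugate * X * P.adjugate * Z * P.adjugate * Y).trace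
      = P.det * entryDet X Y Z P := by
  simp only [Matrix.trace_fin_two, Matrix.sub_apply, Matrix.mul_apply, Fin.sum_univ_two]
  simp [entryDet, Matrix.det_succ_row_zero, Matrix.adjugate_fin_two,
    Fin.sum_univ_succ, Fin.succAbove]
  ring

theorem entryDet_pencil (X Y Z W : Matrix (Fin 2) (Fin 2) ℂ) (a b c d : ℂ) :
    entryDet X Y Z (a • X + b • Y + c • Z + d • W) = d * entryDet X Y Z W := by
  simp [entryDet, Matrix.det_succ_row_zero, Fin.sum_univ_succ, Fin.succAbove]
  ring

/-- For four `2×2` complex matrices `A₁,…,A₄` with pencil `A(z) = ∑ z_j A_j` and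
`B(z) = A(z)^#` the adjugate: on `{z : z₄ ≠ 0, det A(z) ≠ 0}` the function
`z ↦ tr(B A₁ B A₂ B A₃ - B A₁ B A₃ B A₂)/(z₄ det A(z))` is constant, equal (up to
sign) to the determinant of the `4×4` matrix `M` whose `j`-th column lists the four
entries of `A_j`. -/
theorem trace_adjugate_pencil_constant (A : Fin 4 → Matrix (Fin 2) (Fin 2) ℂ) :
    ∀ z : Fin 4 → ℂ, z 3 ≠ 0 → (∑ j, z j • A j).det ≠ 0 →
      ((∑ j, z j • A j).adjugate * A 0 * (∑ j, z j • A j).adjugate * A 1 *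
          (∑ j, z j • A j).adjugate * A 2
        - (∑ j, z j • A j).adjugate * A 0 * (∑ j, z j • A j).adjugate * A 2 *
          (∑ j, z j • A j).adjugate * A 1).trace
        / (z 3 * (∑ j, z j • A j).det)
      = (Matrix.of fun i j : Fin 4 =>
          A j (⟨i.val / 2, by omega⟩ : Fin 2) (⟨i.val % 2, by omega⟩ : Fin 2)).det := by
  intro z hz hd
  have hM : (Matrix.of fun i j : Fin 4 =>
      A j (⟨i.val / 2, by omega⟩ : Fin 2) (⟨i.val % 2, by omega⟩ : Fin 2))
      = Matrix.of ![![A 0 0 0, A 1 0 0, A 2 0 0, A 3 0 0], ![A 0 0 1, A 1 0 1, A 2 0 1, A 3 0 1],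
        ![A 0 1 0, A 1 1 0, A 2 1 0, A 3 1 0], ![A 0 1 1, A 1 1 1, A 2 1 1, A 3 1 1]] := by
    ext i j
    fin_cases i <;> fin_cases j <;> rfl
  rw [trace_eq_det_mul_entryDet, div_eq_iff (mul_ne_zero hz hd), hM]
  have h : entryDet (A 0) (A 1) (A 2) (∑ j, z j • A j)
      = z 3 * entryDet (A 0) (A 1) (A 2) (A 3) := by
    rw [Fin.sum_univ_four, entryDet_pencil]
  rw [h, entryDet]
  ring
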